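/- For every n ≥ 1 there exists a deterministic Büchi automaton over Fin 3 with at most 2^n + 1 states whose language equals L_n^ω. -/

import Mathlib

/-- The unique run of a deterministic Büchi automaton with (total) transition function `δ`
and initial state `q0` on the ω-word `α`. -/
def dbaRun {Q : Type} (δ : Q → Fin 3 → Q) (q0 : Q) (α : ℕ → Fin 3) : ℕ → Q
  | 0 => q0
  | i + 1 => δ (dbaRun δ q0 α i) (α i)

/-- `LnOmega n` is the ω-language `L_n^ω`: ω-words containing infinitely many factors
from `1·{0,1}^{n-1}·2` (letter `2 : Fin 3` plays the role of the end-marker `$`). -/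
def LnOmega (n : ℕ) : Set (ℕ → Fin 3) :=
  {α | {i : ℕ | α i = 1 ∧ (∀ k, 1 ≤ k → k < n → α (i + k) ≠ 2) ∧ α (i + n) = 2}.Infinite}

/-- transition on natural numbers -/
def stepN (n s : ℕ) (a : Fin 3) : ℕ :=
  if a = 2 then (if s.testBit (n - 1) && decide (s ≠ 2 ^ n) then 2 ^ n else 0)
  else (2 * s + a.val) % 2 ^ n

theorem stepN_lt (n s : ℕ) (a : Fin 3) : stepN n s a < 2 ^ n + 1 := by
  unfold stepN
  have : (2 * s + a.val) % 2 ^ n < 2 ^ n := Nat.mod_lt _ (by positivity)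
  split_ifs <;> omega

theorem run_bits (n : ℕ) (α : ℕ → Fin 3) (r : ℕ → ℕ) (h0 : r 0 = 0)
    (hs : ∀ i, r (i + 1) = stepN n (r i) (α i)) (i : ℕ) :
    ∀ j, j < n → ((r i).testBit j = true ↔
      ∃ p, p + j + 1 = i ∧ α p = 1 ∧ ∀ k, 1 ≤ k → k ≤ j → α (p + k) ≠ 2) := by
  induction i with
  | zero => intro j _; simp [h0]
  | succ i ih =>
    intro j hj
    rw [hs]
    by_cases ha : α i = 2
    · have h1 : (stepN n (r i) (α i)).testBit j = false := by
        unfold stepN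
        rw [if_pos ha]
        split_ifs
        · rw [Nat.testBit_two_pow]; simp; omega
        · simp
      rw [h1]
      constructor
      · intro h; simp at h
      · rintro ⟨p, hp, h3, h2⟩
        have hp : p + j = i := by omega
        rcases Nat.eq_zero_or_pos j with h | h
        · subst h
          simp at hp
          subst hp
          rw [h3] at ha
          simp at ha
        · exact absurd (hp ▸ ha) (h2 j h le_rfl)
    · unfold stepN
      rw [if_neg ha, Nat.testBit_mod_two_pow]
      cases j with
      | zero =>
        have : (α i).val < 2 := by
          have := (α i).isLt
          have h3 : (α i).val ≠ 2 := fun h => ha (Fin.ext h)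
          omega
        have h4 : α i = 1 ↔ (α i).val = 1 := Fin.ext_iff
        simp only [hj, decide_true, Bool.true_and, Nat.testBit_zero, decide_eq_true_eq]
        constructor
        · intro h
          exact ⟨i, rfl, h4.2 (by omega), fun k h1 h2 => by omega⟩
        · rintro ⟨p, hp, h1, -⟩
          have : p = i := by omega
          subst this
          have := h4.1 h1
          omega
      | succ j =>
        have : (α i).val < 2 := by
          have := (α i).isLt
          have h3 : (α i).val ≠ 2 := fun h => ha (Fin.ext h)
          omega
        have h5 : (2 * r i + (α i).val) / 2 = r i := by omega
        simp only [hj, decide_true, Bool.true_and, Nat.testBit_succ, h5]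
        rw [ih j (by omega)]
        constructor
        · rintro ⟨p, hp, h3, h2⟩
          refine ⟨p, by omega, h3, fun k hk hk' => ?_⟩
          rcases Nat.lt_or_ge j k with h | h
          · have : p + k = i := by omega
            rwa [this]
          · exact h2 k hk h
        · rintro ⟨p, hp, h3, h2⟩
          exact ⟨p, by omega, h3, fun k hk hk' => h2 k hk (by omega)⟩

theorem run_acc (n : ℕ) (hn : 1 ≤ n) (α : ℕ → Fin 3) (r : ℕ → ℕ) (h0 : r 0 = 0)
    (hs : ∀ i, r (i + 1) = stepN n (r i) (α i)) :
    {i | r i = 2 ^ n} = (fun i => i + (n + 1)) ''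
      {i : ℕ | α i = 1 ∧ (∀ k, 1 ≤ k → k < n → α (i + k) ≠ 2) ∧ α (i + n) = 2} := by
  have hpos : 0 < 2 ^ n := by positivity
  ext i
  simp only [Set.mem_setOf_eq, Set.mem_image]
  cases i with
  | zero =>
    constructor
    · intro h; omega
    · rintro ⟨p, _, h⟩; omega
  | succ i =>
    have hb := run_bits n α r h0 hs i (n - 1) (by omega)
    have hne : (r i).testBit (n - 1) = true → r i ≠ 2 ^ n := by
      intro h h'
      rw [h', Nat.testBit_two_pow] at h
      simp at h
      omega
    have key : r (i + 1) = 2 ^ n ↔ α i = 2 ∧ (r i).testBit (n - 1) = true := by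
      rw [hs]
      unfold stepN
      have : (2 * r i + (α i).val) % 2 ^ n < 2 ^ n := Nat.mod_lt _ hpos
      split_ifs with h1 h2
      · simp at h2; simp [h1, h2.1]
      · have : ¬ (r i).testBit (n - 1) = true := fun h => h2 (by simp [h, hne h])
        constructor
        · intro h; omega
        · intro h; exact absurd h.2 this
      · constructor
        · intro h; omega
        · intro h; exact absurd h.1 h1
    rw [key, hb]
    constructor
    · rintro ⟨h2, p, hp, h1, hk⟩
      have : p + n = i := by omega
      exact ⟨p, ⟨h1, fun k a b => hk k a (by omega), this ▸ h2⟩, by omega⟩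
    · rintro ⟨p, ⟨h1, hk, h2⟩, hp⟩
      have : p + n = i := by omega
      exact ⟨this ▸ h2, p, by omega, h1, fun k a b => hk k a (by omega)⟩

/-- For every `n ≥ 1` there is a deterministic Büchi automaton over `Fin 3` with at most
`2^n + 1` states whose language equals `L_n^ω`. -/
theorem stmt_3 (n : ℕ) (hn : 1 ≤ n) :
    ∃ (m : ℕ) (δ : Fin m → Fin 3 → Fin m) (q0 : Fin m) (F : Set (Fin m)),
      m ≤ 2 ^ n + 1 ∧
      {α : ℕ → Fin 3 | {i : ℕ | dbaRun δ q0 α i ∈ F}.Infinite} = LnOmega n := by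
  refine ⟨2 ^ n + 1, fun s a => ⟨stepN n s.val a, stepN_lt n s.val a⟩, 0,
    {s | s.val = 2 ^ n}, le_rfl, ?_⟩
  ext α
  have h := run_acc n hn α (fun i => (dbaRun (fun (s : Fin (2 ^ n + 1)) a =>
    (⟨stepN n s.val a, stepN_lt n s.val a⟩ : Fin (2 ^ n + 1))) 0 α i).val) rfl (fun i => rfl)
  simp only [LnOmega, Set.mem_setOf_eq]
  rw [h]
  exact Set.infinite_image_iff (fun a _ b _ hab => by simpa using hab)
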